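/- arXiv:2406.01295 — 2 statements merged into one kernel-verified Lean document; each statement's English description precedes it below -/
import Mathlib

section
/- With the convergents p n / q n of the accelerated ln 2 continued fraction (η = 3 + 2√2, S k = −(k+1)²(2k+1)²(4k−1)(4k+7), T k = −2(4k+5)(6k²+15k+8), U k = 3(4k+3)(4k+5)(4k+7), p 0 = 0, q 0 = 1, p 1 = 6η, q 1 = −2+9η, p 2 = (T 0+ηU 0)p 1 − S 0 p 0, q 2 = (T 0+ηU 0)q 1 − S 0 q 0, and u(n+2) = (T n+ηU n)u(n+1) + S n·u n for n ≥ 1), there exists a constant C > 0 such that for all n ≥ 1, |p n / q n − ln 2| ≤ C·(33 + 24√2 + 4·√(140 + 99√2))^(−2n). -/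
/-- The three-term recurrence satisfied by the Legendre functions of both kinds. -/
def IsLegendreSeq (x : ℝ) (L : ℕ → ℝ) : Prop :=
  ∀ m : ℕ, ((m : ℝ) + 2) * L (m + 2) = (2 * m + 3) * x * L (m + 1) - (m + 1) * L m

/-- Legendre polynomials, evaluated at `x`. -/
noncomputable def legendreP (x : ℝ) : ℕ → ℝ
  | 0 => 1
  | 1 => x
  | m + 2 => ((2 * m + 3) * x * legendreP x (m + 1) - (m + 1) * legendreP x m) / (m + 2)

/-- Legendre functions of the second kind at `x > 1`, through their integral representation. -/
noncomputable def legendreQ (x : ℝ) (m : ℕ) : ℝ :=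
  ∫ t in (-1 : ℝ)..1, ((1 - t ^ 2) / (2 * (x - t))) ^ m * (2 * (x - t))⁻¹

theorem isLegendreSeq_legendreP (x : ℝ) : IsLegendreSeq x (legendreP x) := by
  intro m
  have hm : (m : ℝ) + 2 ≠ 0 := by positivity
  rw [legendreP]
  field_simp

theorem continuousOn_legendreQ_integrand {x : ℝ} (hx : 1 < x) (m : ℕ) :
    ContinuousOn (fun t : ℝ => ((1 - t ^ 2) / (2 * (x - t))) ^ m * (2 * (x - t))⁻¹)
      (Set.uIcc (-1) 1) := by
  have h : ∀ t ∈ Set.uIcc (-1 : ℝ) 1, 2 * (x - t) ≠ 0 := by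
    intro t ht
    rw [Set.uIcc_of_le (by norm_num)] at ht
    have := ht.2
    exact ne_of_gt (by linarith)
  have h2 : ContinuousOn (fun t : ℝ => 2 * (x - t)) (Set.uIcc (-1) 1) := by fun_prop
  exact ((ContinuousOn.div (by fun_prop) h2 h).pow m).mul (h2.inv₀ h)

theorem intervalIntegrable_legendreQ_integrand {x : ℝ} (hx : 1 < x) (m : ℕ) :
    IntervalIntegrable (fun t : ℝ => ((1 - t ^ 2) / (2 * (x - t))) ^ m * (2 * (x - t))⁻¹)
      MeasureTheory.volume (-1) 1 :=
  (continuousOn_legendreQ_integrand hx m).intervalIntegrable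

theorem isLegendreSeq_legendreQ {x : ℝ} (hx : 1 < x) : IsLegendreSeq x (legendreQ x) := by
  intro m
  have hpos : ∀ t ∈ Set.uIcc (-1 : ℝ) 1, x - t ≠ 0 := by
    intro t ht
    rw [Set.uIcc_of_le (by norm_num)] at ht
    have := ht.2
    exact ne_of_gt (by linarith)
  have i0 := intervalIntegrable_legendreQ_integrand hx m
  have i1 := intervalIntegrable_legendreQ_integrand hx (m + 1)
  have i2 := intervalIntegrable_legendreQ_integrand hx (m + 2)
  have key := intervalIntegral.integral_eq_sub_of_hasDerivAt
    (a := -1) (b := 1)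
    (f := fun t : ℝ => ((1 - t ^ 2) / (2 * (x - t))) ^ (m + 1) *
      ((1 - 2 * x * t + t ^ 2) / (4 * (x - t))))
    (f' := fun t : ℝ => ((m : ℝ) + 2) *
        (((1 - t ^ 2) / (2 * (x - t))) ^ (m + 2) * (2 * (x - t))⁻¹) -
      (2 * m + 3) * x * (((1 - t ^ 2) / (2 * (x - t))) ^ (m + 1) * (2 * (x - t))⁻¹) +
      (m + 1) * (((1 - t ^ 2) / (2 * (x - t))) ^ m * (2 * (x - t))⁻¹))
    (fun t ht => by
      have ht0 := hpos t ht
      have hl : HasDerivAt (fun t : ℝ => x - t) (-1) t := by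
        simpa using (hasDerivAt_id t).const_sub x
      have hs : HasDerivAt (fun t : ℝ => t ^ 2) (2 * t) t := by
        simpa using hasDerivAt_pow 2 t
      have hg : HasDerivAt (fun t : ℝ => (1 - t ^ 2) / (2 * (x - t)))
          ((1 - 2 * x * t + t ^ 2) / (2 * (x - t) ^ 2)) t := by
        refine ((hs.const_sub 1).div (hl.const_mul 2) (by simpa using ht0)).congr_deriv ?_
        field_simp
        ring
      have hh : HasDerivAt (fun t : ℝ => (1 - 2 * x * t + t ^ 2) / (4 * (x - t)))
          ((1 - 2 * x ^ 2 + 2 * x * t - t ^ 2) / (4 * (x - t) ^ 2)) t := by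
        refine (((((hasDerivAt_id t).const_mul (2 * x)).const_sub 1).add hs).div
          (hl.const_mul 4) (by simpa using ht0)).congr_deriv ?_
        simp only [Pi.add_apply, id]
        field_simp
        ring
      refine ((hg.pow (m + 1)).mul hh).congr_deriv ?_
      simp only [Pi.pow_apply, Nat.add_sub_cancel, pow_succ]
      push_cast
      generalize ((1 - t ^ 2) / (2 * (x - t))) ^ m = G
      field_simp
      ring)
    (((i2.const_mul _).sub (i1.const_mul _)).add (i0.const_mul _))
  rw [intervalIntegral.integral_add ((i2.const_mul _).sub (i1.const_mul _)) (i0.const_mul _),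
    intervalIntegral.integral_sub (i2.const_mul _) (i1.const_mul _)] at key
  simp only [intervalIntegral.integral_const_mul] at key
  have e1 : (1 - (1 : ℝ) ^ 2) / (2 * (x - 1)) = 0 := by norm_num
  have e2 : (1 - (-1 : ℝ) ^ 2) / (2 * (x - -1)) = 0 := by norm_num
  rw [e1, e2, zero_pow (Nat.succ_ne_zero m), zero_mul, zero_mul, sub_zero] at key
  simp only [legendreQ]
  linarith

theorem legendreQ_zero {x : ℝ} (hx : 1 < x) :
    legendreQ x 0 = Real.log ((x + 1) / (x - 1)) / 2 := by
  have h : ∀ t : ℝ, (2 * (x - t))⁻¹ = 2⁻¹ * (x - t)⁻¹ := fun t => mul_inv _ _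
  simp only [legendreQ, pow_zero, one_mul, h, intervalIntegral.integral_const_mul]
  rw [intervalIntegral.integral_comp_sub_left (fun t => t⁻¹) x,
    integral_inv_of_pos (by linarith) (by linarith)]
  rw [sub_neg_eq_add]
  ring

theorem legendreQ_one {x : ℝ} (hx : 1 < x) : legendreQ x 1 = x * legendreQ x 0 - 1 := by
  have i0 := intervalIntegrable_legendreQ_integrand hx 0
  have i1 := intervalIntegrable_legendreQ_integrand hx 1
  have hpos : ∀ t ∈ Set.uIcc (-1 : ℝ) 1, x - t ≠ 0 := by
    intro t ht
    rw [Set.uIcc_of_le (by norm_num)] at ht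
    have := ht.2
    exact ne_of_gt (by linarith)
  have key := intervalIntegral.integral_eq_sub_of_hasDerivAt
    (a := -1) (b := 1)
    (f := fun t : ℝ => (1 - 2 * x * t + t ^ 2) / (4 * (x - t)))
    (f' := fun t : ℝ => ((1 - t ^ 2) / (2 * (x - t))) ^ 1 * (2 * (x - t))⁻¹ -
      x * (((1 - t ^ 2) / (2 * (x - t))) ^ 0 * (2 * (x - t))⁻¹))
    (fun t ht => by
      have ht0 := hpos t ht
      have hl : HasDerivAt (fun t : ℝ => x - t) (-1) t := by
        simpa using (hasDerivAt_id t).const_sub x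
      have hs : HasDerivAt (fun t : ℝ => t ^ 2) (2 * t) t := by
        simpa using hasDerivAt_pow 2 t
      refine (((((hasDerivAt_id t).const_mul (2 * x)).const_sub 1).add hs).div
        (hl.const_mul 4) (by simpa using ht0)).congr_deriv ?_
      simp only [Pi.add_apply, id]
      field_simp
      ring)
    (i1.sub (i0.const_mul _))
  rw [intervalIntegral.integral_sub i1 (i0.const_mul _)] at key
  simp only [intervalIntegral.integral_const_mul] at key
  have h1 : x - 1 ≠ 0 := by linarith
  have h2 : x - -1 ≠ 0 := by linarith
  have e : (1 - 2 * x * 1 + 1 ^ 2) / (4 * (x - 1)) -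
      (1 - 2 * x * (-1) + (-1) ^ 2) / (4 * (x - -1)) = -1 := by
    field_simp
    ring
  rw [e] at key
  simp only [legendreQ]
  linarith

theorem legendreQ_nonneg {x : ℝ} (hx : 1 < x) (m : ℕ) : 0 ≤ legendreQ x m := by
  refine intervalIntegral.integral_nonneg (by norm_num) fun t ht => ?_
  have h1 : 0 ≤ 1 - t ^ 2 := by nlinarith [ht.1, ht.2]
  have h2 : 0 < x - t := by linarith [ht.2]
  positivity

theorem legendreQ_succ_le {x w : ℝ} (hx : 1 < x) (hw : 0 < w) (hxw : w ^ 2 + 1 = 2 * x * w)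
    (m : ℕ) : legendreQ x (m + 1) ≤ w⁻¹ * legendreQ x m := by
  rw [legendreQ, legendreQ, ← intervalIntegral.integral_const_mul]
  refine intervalIntegral.integral_mono_on (by norm_num)
    (intervalIntegrable_legendreQ_integrand hx (m + 1))
    ((intervalIntegrable_legendreQ_integrand hx m).const_mul _) fun t ht => ?_
  have h1 : 0 ≤ 1 - t ^ 2 := by nlinarith [ht.1, ht.2]
  have h2 : 0 < x - t := by linarith [ht.2]
  have hg : (1 - t ^ 2) / (2 * (x - t)) ≤ w⁻¹ := by
    rw [inv_eq_one_div, div_le_div_iff₀ (by positivity) hw]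
    refine le_of_mul_le_mul_right ?_ hw
    nlinarith [sq_nonneg (w * t - 1)]
  rw [pow_succ', mul_assoc]
  exact mul_le_mul_of_nonneg_right hg (by positivity)

theorem legendreP_pos_and_mul_le {x : ℝ} (hx : 1 < x) (m : ℕ) :
    0 < legendreP x m ∧ x * legendreP x m ≤ legendreP x (m + 1) := by
  induction m with
  | zero => simp [legendreP]
  | succ m ih =>
    obtain ⟨h0, h1⟩ := ih
    have hp : 0 < legendreP x (m + 1) := lt_of_lt_of_le (by positivity) h1
    refine ⟨hp, ?_⟩
    have hr := isLegendreSeq_legendreP x m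
    have hm : (0 : ℝ) ≤ m := m.cast_nonneg
    have hle : legendreP x m ≤ x * legendreP x (m + 1) := by nlinarith
    have : ((m : ℝ) + 2) * (x * legendreP x (m + 1)) ≤ (m + 2) * legendreP x (m + 2) := by
      nlinarith
    exact le_of_mul_le_mul_left this (by positivity)

theorem legendreP_ratio_lower {x w : ℝ} (hx : 1 < x) (hw : 10 ≤ w)
    (hxw : w ^ 2 + 1 = 2 * x * w) (m : ℕ) :
    w * (8 * ((m : ℝ) + 1) ^ 2 - 4 * (m + 1) - 1) * legendreP x m ≤
      8 * ((m : ℝ) + 1) ^ 2 * legendreP x (m + 1) := by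
  induction m with
  | zero =>
    have : w ≤ 2 * x := by nlinarith
    simp only [legendreP]
    norm_num
    linarith
  | succ m ih =>
    have hm : (0 : ℝ) ≤ m := m.cast_nonneg
    have hr := isLegendreSeq_legendreP x m
    have hp := (legendreP_pos_and_mul_le hx (m + 1)).1
    have hw0 : 0 < w := by linarith
    set A := legendreP x m
    set B := legendreP x (m + 1)
    change w * (8 * (((m + 1 : ℕ) : ℝ) + 1) ^ 2 - 4 * (((m + 1 : ℕ) : ℝ) + 1) - 1) * B ≤
      8 * (((m + 1 : ℕ) : ℝ) + 1) ^ 2 * legendreP x (m + 2)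
    set D := legendreP x (m + 2)
    push_cast
    set M : ℝ := (m : ℝ) + 1 with hM
    have hM1 : 1 ≤ M := by linarith
    have hR : 0 < 8 * M ^ 2 - 4 * M - 1 := by nlinarith
    have hr' : (M + 1) * (D * (2 * w)) = (2 * M + 1) * (w ^ 2 + 1) * B - 2 * M * (w * A) := by
      rw [hxw]
      linear_combination (2 * w) * hr
    have hpoly : 4 * (6 * M + 1) * (M + 1) ≤ w ^ 2 * (8 * M ^ 2 - 4 * M - 1) := by
      have : 100 * (8 * M ^ 2 - 4 * M - 1) ≤ w ^ 2 * (8 * M ^ 2 - 4 * M - 1) :=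
        mul_le_mul_of_nonneg_right (by nlinarith) hR.le
      nlinarith
    refine le_of_mul_le_mul_left ?_ (mul_pos hw0 hR)
    have h1 := mul_le_mul_of_nonneg_left ih (show 0 ≤ 8 * M * (M + 1) by positivity)
    have h2 := mul_le_mul_of_nonneg_right hpoly hp.le
    have e : w * (8 * M ^ 2 - 4 * M - 1) * (8 * (M + 1) ^ 2 * D) =
        4 * (M + 1) * (8 * M ^ 2 - 4 * M - 1) * ((2 * M + 1) * (w ^ 2 + 1) * B) -
        8 * M * (M + 1) * (w * (8 * M ^ 2 - 4 * M - 1) * A) := by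
      linear_combination 4 * (M + 1) * (8 * M ^ 2 - 4 * M - 1) * hr'
    rw [e]
    nlinarith

theorem pow_le_legendreP_sq {x w : ℝ} (hx : 1 < x) (hw : 10 ≤ w)
    (hxw : w ^ 2 + 1 = 2 * x * w) (m : ℕ) :
    w ^ (2 * (m + 1)) ≤ 4 * (((m : ℝ) + 1) * legendreP x (m + 1) ^ 2) := by
  have hw0 : 0 < w := by linarith
  induction m with
  | zero =>
    have : w ≤ 2 * x := by nlinarith
    simp only [legendreP]
    norm_num
    nlinarith
  | succ m ih =>
    have hr := legendreP_ratio_lower hx hw hxw (m + 1)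
    have hp := (legendreP_pos_and_mul_le hx (m + 1)).1
    have hm : (0 : ℝ) ≤ m := m.cast_nonneg
    push_cast at hr ⊢
    set B := legendreP x (m + 1)
    set D := legendreP x (m + 1 + 1)
    set N : ℝ := (m : ℝ) + 1 + 1 with hN
    have hN2 : 2 ≤ N := by linarith
    have hR : 0 < 8 * N ^ 2 - 4 * N - 1 := by nlinarith
    have hsq := pow_le_pow_left₀ (by positivity) hr 2
    have hpoly : 64 * N ^ 3 * (N - 1) ≤ (8 * N ^ 2 - 4 * N - 1) ^ 2 := by nlinarith
    have hstep : w ^ 2 * (N - 1) * B ^ 2 ≤ N * D ^ 2 := by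
      refine le_of_mul_le_mul_left ?_ (show 0 < 64 * N ^ 3 by positivity)
      have := mul_le_mul_of_nonneg_right hpoly (show 0 ≤ w ^ 2 * B ^ 2 by positivity)
      nlinarith
    have e : w ^ (2 * (m + 1 + 1)) = w ^ 2 * w ^ (2 * (m + 1)) := by ring
    rw [e]
    have h3 := mul_le_mul_of_nonneg_left ih (sq_nonneg w)
    have e2 : (m : ℝ) + 1 = N - 1 := by rw [hN]; ring
    rw [e2] at h3
    nlinarith

theorem legendre_casoratian {x : ℝ} (hx : 1 < x) (m : ℕ) :
    ((m : ℝ) + 1) * (legendreP x (m + 1) * legendreQ x m - legendreP x m * legendreQ x (m + 1)) =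
      1 := by
  induction m with
  | zero =>
    rw [zero_add, legendreQ_one hx]
    simp only [legendreP]
    norm_num
  | succ m ih =>
    have h1 := isLegendreSeq_legendreP x m
    have h2 := isLegendreSeq_legendreQ hx m
    push_cast
    refine Eq.trans ?_ ih
    linear_combination legendreQ x (m + 1) * h1 - legendreP x (m + 1) * h2

theorem legendreQ_div_legendreP_le {x w : ℝ} (hx : 2 ≤ x) (hw : 10 ≤ w)
    (hxw : w ^ 2 + 1 = 2 * x * w) (m : ℕ) :
    legendreQ x (m + 1) / legendreP x (m + 1) ≤ 4 * (w ^ (2 * (m + 1)))⁻¹ := by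
  have hx1 : 1 < x := by linarith
  have hw0 : 0 < w := by linarith
  have hm : (0 : ℝ) ≤ m := m.cast_nonneg
  obtain ⟨hP, hP'⟩ := legendreP_pos_and_mul_le hx1 (m + 1)
  have hc := legendre_casoratian hx1 (m + 1)
  have hQ := legendreQ_nonneg hx1 (m + 1)
  have hQ' := legendreQ_succ_le hx1 hw0 hxw (m + 1)
  have hwinv : w⁻¹ ≤ 1 := inv_le_one_of_one_le₀ (by linarith)
  have hg := pow_le_legendreP_sq hx1 hw hxw m
  push_cast at hc
  set P := legendreP x (m + 1)
  set Q := legendreQ x (m + 1)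
  have hQ1 : legendreQ x (m + 1 + 1) ≤ Q := by nlinarith
  have h1 : P * Q ≤ legendreP x (m + 1 + 1) * Q - P * legendreQ x (m + 1 + 1) := by
    have a := mul_le_mul_of_nonneg_right hP' hQ
    have b := mul_le_mul_of_nonneg_left hQ1 hP.le
    have c := mul_le_mul_of_nonneg_right hx (mul_nonneg hP.le hQ)
    nlinarith
  have h2 : ((m : ℝ) + 1) * (P * Q) ≤ 1 := by
    have := mul_le_mul_of_nonneg_left h1 (show (0 : ℝ) ≤ m + 1 + 1 by positivity)
    nlinarith [mul_nonneg hP.le hQ]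
  rw [← div_eq_mul_inv, div_le_div_iff₀ hP (by positivity)]
  have h3 := mul_le_mul_of_nonneg_right hg hQ
  nlinarith

/-- The scaling factor between the even-indexed Legendre functions at `η = 3 + 2√2` and the
numerators and denominators of the continued fraction. -/
noncomputable def cfScale (n : ℕ) : ℝ :=
  ∏ i ∈ Finset.range (n - 1), ((2 * (i : ℝ) + 3) * (i + 2) * (4 * i + 3))

theorem cfScale_pos (n : ℕ) : 0 < cfScale n :=
  Finset.prod_pos fun _ _ => by positivity

theorem cfScale_add_two (n : ℕ) :
    cfScale (n + 2) = cfScale (n + 1) * ((2 * (n : ℝ) + 3) * (n + 2) * (4 * n + 3)) := by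
  simp [cfScale, Finset.prod_range_succ]

theorem IsLegendreSeq.two_step {x : ℝ} {L : ℕ → ℝ} (hL : IsLegendreSeq x L)
    (hx : x ^ 2 = 6 * x - 1) (n : ℕ) :
    (2 * (n : ℝ) + 3) * (n + 2) * (4 * n + 3) * L (2 * (n + 2)) =
      (-2 * (4 * (n : ℝ) + 5) * (6 * n ^ 2 + 15 * n + 8) +
        x * (3 * (4 * (n : ℝ) + 3) * (4 * n + 5) * (4 * n + 7))) * L (2 * (n + 1)) -
      (4 * n + 7) * (n + 1) * (2 * n + 1) * L (2 * n) := by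
  have h0 := hL (2 * n)
  have h1 := hL (2 * n + 1)
  have h2 := hL (2 * n + 2)
  rw [show 2 * (n + 2) = 2 * n + 2 + 2 by ring, show 2 * (n + 1) = 2 * n + 2 by ring]
  rw [show 2 * n + 2 + 1 = 2 * n + 1 + 2 by ring] at h2
  rw [show 2 * n + 1 + 1 = 2 * n + 2 by ring] at h1
  push_cast at h0 h1 h2
  linear_combination (2 * (n : ℝ) + 3) * (4 * n + 3) / 2 * h2 +
    (4 * (n : ℝ) + 3) * (4 * n + 7) * x / 2 * h1 +
    (4 * (n : ℝ) + 7) * (2 * n + 2) / 2 * h0 +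
    (4 * (n : ℝ) + 3) * (4 * n + 5) * (4 * n + 7) / 2 * L (2 * n + 2) * hx

theorem eq_cfScale_mul {η : ℝ} (hη : η ^ 2 = 6 * η - 1) {S T U : ℕ → ℝ}
    (hS : ∀ k : ℕ, S k = -((k : ℝ) + 1) ^ 2 * (2 * k + 1) ^ 2 * (4 * k - 1) * (4 * k + 7))
    (hT : ∀ k : ℕ, T k = -2 * (4 * (k : ℝ) + 5) * (6 * k ^ 2 + 15 * k + 8))
    (hU : ∀ k : ℕ, U k = 3 * (4 * (k : ℝ) + 3) * (4 * k + 5) * (4 * k + 7))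
    {a L : ℕ → ℝ} (hL : IsLegendreSeq η L) (h0 : a 0 = L 0) (h1 : a 1 = L 2)
    (h2 : a 2 = (T 0 + η * U 0) * a 1 - S 0 * a 0)
    (h : ∀ n : ℕ, 1 ≤ n → a (n + 2) = (T n + η * U n) * a (n + 1) + S n * a n) (n : ℕ) :
    a n = cfScale n * L (2 * n) := by
  induction n using Nat.strong_induction_on with
  | _ n ih =>
    match n with
    | 0 => simp [cfScale, h0]
    | 1 => simp [cfScale, h1]
    | 2 =>
      have := hL.two_step hη 0
      rw [h2, h1, h0, hS, hT, hU, cfScale_add_two 0]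
      norm_num [cfScale] at this ⊢
      linarith
    | k + 3 =>
      have e := hL.two_step hη (k + 1)
      rw [h (k + 1) (by omega), ih (k + 1 + 1) (by omega), ih (k + 1) (by omega), hS, hT, hU,
        show k + 3 = (k + 1) + 2 by ring, cfScale_add_two (k + 1), cfScale_add_two k]
      push_cast at e ⊢
      linear_combination (-cfScale (k + 1) * ((2 * (k : ℝ) + 3) * (k + 2) * (4 * k + 3))) * e


theorem log_two_accelerated_cf_convergents_rate
    (η : ℝ) (hη : η = 3 + 2 * Real.sqrt 2)
    (S T U : ℕ → ℝ)
    (hS : ∀ k : ℕ, S k = -((k : ℝ) + 1) ^ 2 * (2 * k + 1) ^ 2 * (4 * k - 1) * (4 * k + 7))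
    (hT : ∀ k : ℕ, T k = -2 * (4 * (k : ℝ) + 5) * (6 * k ^ 2 + 15 * k + 8))
    (hU : ∀ k : ℕ, U k = 3 * (4 * (k : ℝ) + 3) * (4 * k + 5) * (4 * k + 7))
    (p q : ℕ → ℝ)
    (hp0 : p 0 = 0) (hq0 : q 0 = 1)
    (hp1 : p 1 = 6 * η) (hq1 : q 1 = -2 + 9 * η)
    (hp2 : p 2 = (T 0 + η * U 0) * p 1 - S 0 * p 0)
    (hq2 : q 2 = (T 0 + η * U 0) * q 1 - S 0 * q 0)
    (hp : ∀ n : ℕ, 1 ≤ n → p (n + 2) = (T n + η * U n) * p (n + 1) + S n * p n)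
    (hq : ∀ n : ℕ, 1 ≤ n → q (n + 2) = (T n + η * U n) * q (n + 1) + S n * q n) :
    ∃ C : ℝ, 0 < C ∧ ∀ n : ℕ, 1 ≤ n →
      |p n / q n - Real.log 2| ≤
        C * (33 + 24 * Real.sqrt 2 + 4 * Real.sqrt (140 + 99 * Real.sqrt 2)) ^ (-(2 * (n : ℤ))) := by
  have hs : Real.sqrt 2 ^ 2 = 2 := Real.sq_sqrt (by norm_num)
  have hs1 : 1 ≤ Real.sqrt 2 := Real.one_le_sqrt.mpr (by norm_num)
  have hη2 : η ^ 2 = 6 * η - 1 := by rw [hη]; linear_combination 4 * hs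
  have hη5 : 5 ≤ η := by linarith
  have hη1 : 1 < η := by linarith
  set v := Real.sqrt (η ^ 2 - 1) with hv
  have hv2 : v ^ 2 = η ^ 2 - 1 := Real.sq_sqrt (by nlinarith)
  have hv5 : 5 ≤ v := Real.le_sqrt_of_sq_le (by nlinarith)
  have hroot : 4 * Real.sqrt (140 + 99 * Real.sqrt 2) = 2 * η * v := by
    have : Real.sqrt (140 + 99 * Real.sqrt 2) = η * v / 2 := by
      rw [Real.sqrt_eq_iff_mul_self_eq (by positivity) (by positivity)]
      have e : η * v / 2 * (η * v / 2) = η ^ 2 * (η ^ 2 - 1) / 4 := by rw [← hv2]; ring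
      rw [e, hη2, hη]
      linear_combination -36 * hs
    rw [this]
    ring
  have hbase : 33 + 24 * Real.sqrt 2 + 4 * Real.sqrt (140 + 99 * Real.sqrt 2) = (η + v) ^ 2 := by
    rw [hroot]
    linear_combination -hv2 - 2 * hη2 - 12 * hη
  have hw : 10 ≤ η + v := by linarith
  have hxw : (η + v) ^ 2 + 1 = 2 * η * (η + v) := by linear_combination hv2
  have hlog : Real.log 2 = 4 * legendreQ η 0 := by
    have hq : (η + 1) / (η - 1) = Real.sqrt 2 := by
      rw [div_eq_iff (by linarith), hη]
      linear_combination -2 * hs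
    rw [legendreQ_zero hη1, hq, Real.log_sqrt (by norm_num)]
    ring
  have hqP : ∀ n, q n = cfScale n * legendreP η (2 * n) :=
    eq_cfScale_mul hη2 hS hT hU (isLegendreSeq_legendreP η) (by simp [hq0, legendreP])
      (by
        rw [hq1]
        simp only [legendreP]
        push_cast
        linear_combination -3 / 2 * hη2) hq2 hq
  have hpW : ∀ n, p n = cfScale n *
      (4 * (legendreP η (2 * n) * legendreQ η 0 - legendreQ η (2 * n))) := by
    refine eq_cfScale_mul
      (L := fun m => 4 * (legendreP η m * legendreQ η 0 - legendreQ η m))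
      hη2 hS hT hU (fun m => ?_) ?_ ?_ hp2 hp
    · linear_combination 4 * legendreQ η 0 * isLegendreSeq_legendreP η m -
        4 * isLegendreSeq_legendreQ hη1 m
    · simp [hp0, legendreP]
    · have e := isLegendreSeq_legendreQ hη1 0
      rw [zero_add, zero_add, legendreQ_one hη1] at e
      rw [hp1]
      simp only [legendreP]
      push_cast at e ⊢
      linear_combination 2 * e
  refine ⟨16, by norm_num, fun n hn => ?_⟩
  have hP := (legendreP_pos_and_mul_le hη1 (2 * n)).1
  have herr : p n / q n - Real.log 2 = -(4 * (legendreQ η (2 * n) / legendreP η (2 * n))) := by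
    have hc := cfScale_pos n
    rw [hpW, hqP, hlog]
    field_simp
    ring
  have hbound := legendreQ_div_legendreP_le (by linarith) hw hxw (2 * n - 1)
  rw [show 2 * n - 1 + 1 = 2 * n by omega] at hbound
  rw [herr, abs_neg, abs_of_nonneg
    (mul_nonneg (by norm_num) (div_nonneg (legendreQ_nonneg hη1 _) hP.le)), hbase, zpow_neg]
  have e : ((η + v) ^ 2) ^ (2 * (n : ℤ)) = (η + v) ^ (2 * (2 * n)) := by
    rw [pow_mul]
    exact_mod_cast zpow_natCast ((η + v) ^ (2 : ℕ)) (2 * n)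
  rw [e]
  linarith
end

section
/- Let ω' = 7 + 4√2 and for k ∈ ℕ set S' k = −16·(k+2)²·(2k+1)²·(4k+1)·(4k+9), T' k = 9(4k+7), U' k = (4k+5)(4k+7)(4k+9). Define p, q : ℕ → ℝ by p 0 = 1, q 0 = 1, p 1 = (13 − 15ω') + (15 − 5ω'), q 1 = 13 − 15ω', p 2 = (T' 0 + ω'·U' 0)·p 1 − S' 0·p 0, q 2 = (T' 0 + ω'·U' 0)·q 1 − S' 0·q 0, and for all n ≥ 1, p (n+2) = (T' n + ω'·U' n)·p (n+1) + S' n·p n and q (n+2) = (T' n + ω'·U' n)·q (n+1) + S' n·q n. Then the sequence q n / p n converges to π/4 (equivalently, p n / q n → 4/π). -/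
open Real Filter Topology

/-- The integrand `u²ᵏ(1 - u²)ᵏ⁺¹ / (w² + u²)ᵏ⁺²`, whose integral over `[0, 1]` is, up to a power
of two and a factor depending on `w` only, the Jacobi function of the second kind with parameters
`(-3/2, 0)` and degree `k + 1` at `2 w² + 1`. -/
noncomputable def jacobiIntegrand (w : ℝ) (k : ℕ) (u : ℝ) : ℝ :=
  u ^ (2 * k) * (1 - u ^ 2) ^ (k + 1) / (w ^ 2 + u ^ 2) ^ (k + 2)

noncomputable def jacobiIntegral (w : ℝ) (k : ℕ) : ℝ :=
  ∫ u in (0 : ℝ)..1, jacobiIntegrand w k u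

/-- The factor relating the Jacobi normalization to that of the continued fraction. -/
noncomputable def jacobiScale (k : ℕ) : ℝ :=
  ∏ i ∈ Finset.range k, 4 * ((i : ℝ) + 2) * (2 * i + 1) * (4 * i + 1)

lemma jacobiScale_succ (k : ℕ) :
    jacobiScale (k + 1) = jacobiScale k * (4 * ((k : ℝ) + 2) * (2 * k + 1) * (4 * k + 1)) :=
  Finset.prod_range_succ _ _

lemma jacobiScale_pos (k : ℕ) : 0 < jacobiScale k :=
  Finset.prod_pos fun i _ => by positivity

lemma continuous_jacobiIntegrand {w : ℝ} (hw : 0 < w) (k : ℕ) :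
    Continuous (jacobiIntegrand w k) := by
  unfold jacobiIntegrand
  exact Continuous.div (by fun_prop) (by fun_prop) fun u => by positivity

lemma abs_jacobiIntegral_le {w : ℝ} (hw : 1 ≤ w) (k : ℕ) : |jacobiIntegral w k| ≤ 1 := by
  have h := intervalIntegral.norm_integral_le_of_norm_le_const (a := 0) (b := 1) (C := 1)
    (f := jacobiIntegrand w k) fun u hu => by
      rw [Set.uIoc_of_le zero_le_one] at hu
      obtain ⟨h0, h1⟩ := hu
      have hu2 : u ^ 2 ≤ 1 := pow_le_one₀ h0.le h1
      have hden : 1 ≤ w ^ 2 + u ^ 2 := by nlinarith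
      have hsub : 0 ≤ 1 - u ^ 2 := by linarith
      rw [jacobiIntegrand, Real.norm_of_nonneg (by positivity)]
      refine div_le_one_of_le₀ ?_ (by positivity)
      calc u ^ (2 * k) * (1 - u ^ 2) ^ (k + 1) ≤ 1 * 1 := by
            gcongr
            · exact pow_le_one₀ h0.le h1
            · exact pow_le_one₀ hsub (by nlinarith)
        _ ≤ (w ^ 2 + u ^ 2) ^ (k + 2) := by simpa using one_le_pow₀ hden
  simpa [jacobiIntegral] using h

/-- The three-term recurrence of the integrands, up to a derivative. -/
lemma hasDerivAt_jacobiIntegrand_certificate {w : ℝ} (hw : 0 < w) (k : ℕ) (u : ℝ) :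
    HasDerivAt (fun u : ℝ => u ^ (2 * k + 1) * (1 - u ^ 2) ^ (k + 2) / (w ^ 2 + u ^ 2) ^ (k + 3) *
        (4 * w ^ 2 * (k + 2) * (4 * k + 9)
          + (6 * (4 * k + 7) - 2 * (4 * k + 9) * (4 * k + 5) * w ^ 2) * u ^ 2
          - 4 * (k + 3) * (4 * k + 5) * u ^ 4))
      (4 * (k + 3) * (2 * k + 3) * (4 * k + 5) * jacobiIntegrand w (k + 2) u
        - (4 * k + 7) * ((4 * k + 5) * (4 * k + 9) * (2 * w ^ 2 + 1) + 9)
          * jacobiIntegrand w (k + 1) u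
        + 4 * (k + 2) * (2 * k + 1) * (4 * k + 9) * jacobiIntegrand w k u) u := by
  have hden : w ^ 2 + u ^ 2 ≠ 0 := by positivity
  have hid := hasDerivAt_id u
  have hsq := hid.pow 2
  have hnum := (hid.pow (2 * k + 1)).mul ((hsq.const_sub 1).pow (k + 2))
  have hquot := hnum.div ((hsq.const_add (w ^ 2)).pow (k + 3)) (pow_ne_zero _ hden)
  have hpoly := ((hsq.const_mul
    (6 * (4 * (k : ℝ) + 7) - 2 * (4 * k + 9) * (4 * k + 5) * w ^ 2)).const_add
    (4 * w ^ 2 * ((k : ℝ) + 2) * (4 * k + 9))).sub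
    ((hid.pow 4).const_mul (4 * ((k : ℝ) + 3) * (4 * k + 5)))
  refine (hquot.mul hpoly).congr_deriv ?_
  simp only [jacobiIntegrand, Pi.mul_apply, Pi.pow_apply, Pi.div_apply, Pi.sub_apply, id,
    Nat.add_sub_cancel, show k + 2 - 1 = k + 1 from rfl, show k + 3 - 1 = k + 2 from rfl]
  push_cast
  field_simp
  ring

lemma jacobiIntegral_recurrence {w : ℝ} (hw : 0 < w) (k : ℕ) :
    4 * ((k : ℝ) + 3) * (2 * k + 3) * (4 * k + 5) * jacobiIntegral w (k + 2)
      = (4 * k + 7) * ((4 * k + 5) * (4 * k + 9) * (2 * w ^ 2 + 1) + 9) * jacobiIntegral w (k + 1)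
        - 4 * (k + 2) * (2 * k + 1) * (4 * k + 9) * jacobiIntegral w k := by
  have hint (j : ℕ) (c : ℝ) : IntervalIntegrable (fun u => c * jacobiIntegrand w j u)
      MeasureTheory.volume 0 1 :=
    ((continuous_jacobiIntegrand hw j).const_mul c).intervalIntegrable _ _
  have h := intervalIntegral.integral_eq_sub_of_hasDerivAt
    (fun u _ => hasDerivAt_jacobiIntegrand_certificate hw k u)
    (((hint _ _).sub (hint _ _)).add (hint _ _))
  rw [intervalIntegral.integral_add ((hint _ _).sub (hint _ _)) (hint _ _),
    intervalIntegral.integral_sub (hint _ _) (hint _ _)] at h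
  simp only [intervalIntegral.integral_const_mul] at h
  simp at h
  simp only [jacobiIntegral]
  linarith

lemma hasDerivAt_arctan_div {w : ℝ} (hw : 0 < w) (u : ℝ) :
    HasDerivAt (fun u => arctan (u / w) / w) (1 / (w ^ 2 + u ^ 2)) u := by
  refine (((hasDerivAt_id u).div_const w).arctan.div_const w).congr_deriv ?_
  simp only [id]
  field_simp

lemma hasDerivAt_div_sq_add_sq {w : ℝ} (hw : 0 < w) (u : ℝ) :
    HasDerivAt (fun u => u / (w ^ 2 + u ^ 2))
      ((w ^ 2 - u ^ 2) / (w ^ 2 + u ^ 2) ^ 2) u := by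
  have hden : w ^ 2 + u ^ 2 ≠ 0 := by positivity
  have hid := hasDerivAt_id u
  refine (hid.div ((hid.pow 2).const_add (w ^ 2)) hden).congr_deriv ?_
  simp only [id, Pi.pow_apply]
  field_simp
  push_cast
  ring

lemma hasDerivAt_div_sq_add_sq_sq {w : ℝ} (hw : 0 < w) (u : ℝ) :
    HasDerivAt (fun u => u / (w ^ 2 + u ^ 2) ^ 2)
      ((w ^ 2 - 3 * u ^ 2) / (w ^ 2 + u ^ 2) ^ 3) u := by
  have hden : w ^ 2 + u ^ 2 ≠ 0 := by positivity
  have hid := hasDerivAt_id u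
  refine (hid.div (((hid.pow 2).const_add (w ^ 2)).pow 2) (pow_ne_zero 2 hden)).congr_deriv ?_
  simp only [id, Pi.pow_apply]
  field_simp
  push_cast
  ring

lemma jacobiIntegral_zero {w : ℝ} (hw : 0 < w) :
    jacobiIntegral w 0 = (1 + (1 - w ^ 2) * (arctan (1 / w) / w)) / (2 * w ^ 2) := by
  have h := intervalIntegral.integral_eq_sub_of_hasDerivAt (a := 0) (b := 1)
    (f' := jacobiIntegrand w 0) (fun u _ => by
      refine (((hasDerivAt_div_sq_add_sq hw u).const_mul ((w ^ 2 + 1) / (2 * w ^ 2))).add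
        ((hasDerivAt_arctan_div hw u).const_mul ((1 - w ^ 2) / (2 * w ^ 2)))).congr_deriv ?_
      have hden : w ^ 2 + u ^ 2 ≠ 0 := by positivity
      simp only [jacobiIntegrand]
      field_simp
      ring) ((continuous_jacobiIntegrand hw 0).intervalIntegrable _ _)
  rw [jacobiIntegral, h]
  have hden : w ^ 2 + 1 ≠ 0 := by positivity
  simp
  field_simp

lemma jacobiIntegral_one {w : ℝ} (hw : 0 < w) :
    jacobiIntegral w 1 = 3 / 4 + (9 * w ^ 2 + 1) / (8 * w ^ 2)
      + ((w ^ 2 + 1) * (9 * w ^ 2 + 1) / (8 * w ^ 2) - (3 * w ^ 2 + 2))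
        * (arctan (1 / w) / w) := by
  have h := intervalIntegral.integral_eq_sub_of_hasDerivAt (a := 0) (b := 1)
    (f' := jacobiIntegrand w 1) (fun u _ => by
      refine ((((hasDerivAt_id u).add ((hasDerivAt_div_sq_add_sq hw u).const_mul
        ((w ^ 2 + 1) * (9 * w ^ 2 + 1) / (8 * w ^ 2)))).sub
        ((hasDerivAt_div_sq_add_sq_sq hw u).const_mul ((w ^ 2 + 1) ^ 2 / 4))).add
        ((hasDerivAt_arctan_div hw u).const_mul
          ((w ^ 2 + 1) * (9 * w ^ 2 + 1) / (8 * w ^ 2) - (3 * w ^ 2 + 2)))).congr_deriv ?_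
      have hden : w ^ 2 + u ^ 2 ≠ 0 := by positivity
      simp only [jacobiIntegrand]
      field_simp
      ring) ((continuous_jacobiIntegrand hw 1).intervalIntegrable _ _)
  rw [jacobiIntegral, h]
  have hden : w ^ 2 + 1 ≠ 0 := by positivity
  simp
  field_simp
  ring

lemma arctan_inv_one_add_sqrt_two : arctan (1 / (1 + √2)) = π / 8 := by
  have hs : √2 ^ 2 = 2 := Real.sq_sqrt (by norm_num)
  have hlt : 1 / (1 + √2) < 1 := by
    rw [div_lt_one (by positivity)]
    linarith [Real.sqrt_pos.2 (show (0 : ℝ) < 2 by norm_num)]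
  have h := Real.two_mul_arctan (by linarith [show 0 < 1 / (1 + √2) by positivity]) hlt
  have harg : 2 * (1 / (1 + √2)) / (1 - (1 / (1 + √2)) ^ 2) = 1 := by
    have hne : (1 + √2) ^ 2 - 1 ≠ 0 := by nlinarith [Real.sqrt_nonneg 2]
    field_simp
    nlinarith
  rw [harg, Real.arctan_one] at h
  linarith

/-- Any solution of the recurrence with the initial values of the Jacobi integrals is their
multiple. -/
lemma eq_jacobiScale_mul_jacobiIntegral {w κ : ℝ} (hw : 0 < w) {y : ℕ → ℝ}
    (h0 : y 0 = κ * jacobiIntegral w 0) (h1 : y 1 = κ * (8 * jacobiIntegral w 1))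
    (hrec : ∀ k : ℕ, y (k + 2)
      = (4 * k + 7) * ((4 * k + 5) * (4 * k + 9) * (2 * w ^ 2 + 1) + 9) * y (k + 1)
        - 16 * ((k : ℝ) + 2) ^ 2 * (2 * k + 1) ^ 2 * (4 * k + 1) * (4 * k + 9) * y k) (m : ℕ) :
    y m = κ * (jacobiScale m * jacobiIntegral w m) := by
  induction m using Nat.twoStepInduction with
  | zero => simpa [jacobiScale] using h0
  | one => rw [h1]; norm_num [jacobiScale]
  | more k ih0 ih1 =>
    have h := jacobiIntegral_recurrence hw k
    rw [hrec, ih0, ih1, jacobiScale_succ (k + 1), jacobiScale_succ k]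
    push_cast
    linear_combination (-κ * jacobiScale k * (4 * ((k : ℝ) + 2) * (2 * k + 1) * (4 * k + 1))) * h

/-- A solution of the recurrence that starts growing outgrows `jacobiScale` geometrically. -/
lemma two_pow_mul_jacobiScale_le {w : ℝ} (hw : 2 ≤ w) {y : ℕ → ℝ}
    (h0 : y 0 = 1) (h1 : 16 ≤ y 1)
    (hrec : ∀ k : ℕ, y (k + 2)
      = (4 * k + 7) * ((4 * k + 5) * (4 * k + 9) * (2 * w ^ 2 + 1) + 9) * y (k + 1)
        - 16 * ((k : ℝ) + 2) ^ 2 * (2 * k + 1) ^ 2 * (4 * k + 1) * (4 * k + 9) * y k) (m : ℕ) :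
    2 ^ m * jacobiScale m ≤ y m := by
  have hstep (k : ℕ) : 0 < y k ∧
      2 * (4 * ((k : ℝ) + 2) * (2 * k + 1) * (4 * k + 1)) * y k ≤ y (k + 1) := by
    induction k with
    | zero => norm_num [h0, h1]
    | succ k ih =>
      obtain ⟨hpos, hle⟩ := ih
      have hpos' : 0 < y (k + 1) := lt_of_lt_of_le (by positivity) hle
      refine ⟨hpos', ?_⟩
      have hS := mul_le_mul_of_nonneg_left hle
        (show 0 ≤ 2 * ((k : ℝ) + 2) * (2 * k + 1) * (4 * k + 9) by positivity)
      have hcoef : 2 * (4 * ((k : ℝ) + 3) * (2 * k + 3) * (4 * k + 5))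
          ≤ (4 * k + 7) * ((4 * k + 5) * (4 * k + 9) * (2 * w ^ 2 + 1) + 9)
            - 2 * ((k : ℝ) + 2) * (2 * k + 1) * (4 * k + 9) := by
        have hx : 9 ≤ 2 * w ^ 2 + 1 := by nlinarith
        have := mul_le_mul_of_nonneg_left hx
          (show 0 ≤ (4 * (k : ℝ) + 7) * ((4 * k + 5) * (4 * k + 9)) by positivity)
        have hk : (0 : ℝ) ≤ k := k.cast_nonneg
        nlinarith [pow_nonneg hk 2, pow_nonneg hk 3]
      have := mul_le_mul_of_nonneg_right hcoef hpos'.le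
      rw [hrec]
      push_cast
      nlinarith
  induction m with
  | zero => simp [jacobiScale, h0]
  | succ m ih =>
    refine le_trans ?_ (hstep m).2
    have := mul_le_mul_of_nonneg_left ih
      (show 0 ≤ 2 * (4 * ((m : ℝ) + 2) * (2 * m + 1) * (4 * m + 1)) by positivity)
    rw [jacobiScale_succ, pow_succ]
    linarith


theorem pi_simplified_cf_convergents_tendsto
    (ω' : ℝ) (hω' : ω' = 7 + 4 * Real.sqrt 2)
    (S' T' U' : ℕ → ℝ)
    (hS' : ∀ k : ℕ, S' k = -16 * ((k : ℝ) + 2) ^ 2 * (2 * k + 1) ^ 2 * (4 * k + 1) * (4 * k + 9))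
    (hT' : ∀ k : ℕ, T' k = 9 * (4 * (k : ℝ) + 7))
    (hU' : ∀ k : ℕ, U' k = (4 * (k : ℝ) + 5) * (4 * k + 7) * (4 * k + 9))
    (p q : ℕ → ℝ)
    (hp0 : p 0 = 1) (hq0 : q 0 = 1)
    (hp1 : p 1 = (13 - 15 * ω') + (15 - 5 * ω'))
    (hq1 : q 1 = 13 - 15 * ω')
    (hp2 : p 2 = (T' 0 + ω' * U' 0) * p 1 - S' 0 * p 0)
    (hq2 : q 2 = (T' 0 + ω' * U' 0) * q 1 - S' 0 * q 0)
    (hp : ∀ n : ℕ, 1 ≤ n → p (n + 2) = (T' n + ω' * U' n) * p (n + 1) + S' n * p n)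
    (hq : ∀ n : ℕ, 1 ≤ n → q (n + 2) = (T' n + ω' * U' n) * q (n + 1) + S' n * q n) :
    Filter.Tendsto (fun n => q n / p n) Filter.atTop (nhds (Real.pi / 4)) := by
  have hs : √2 ^ 2 = 2 := Real.sq_sqrt (by norm_num)
  have hs1 : 1 ≤ √2 := Real.one_le_sqrt.2 (by norm_num)
  set w : ℝ := 1 + √2 with hw_def
  have hw : 0 < w := by positivity
  have hx : 2 * w ^ 2 + 1 = ω' := by rw [hω', hw_def]; linear_combination 2 * hs
  have hsq : w ^ 2 = 2 * w + 1 := by rw [hw_def]; linear_combination hs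
  have hθ : arctan (1 / w) = π / 8 := arctan_inv_one_add_sqrt_two
  -- Changing the sign of the initial term makes the recurrence uniform.
  set P : ℕ → ℝ := fun n => if n = 0 then 1 else -p n with hP
  set E : ℕ → ℝ := fun n => if n = 0 then -(1 - π / 4) else q n - π / 4 * p n with hE
  have hrec (y : ℕ → ℝ) (h2 : y 2 = (T' 0 + ω' * U' 0) * y 1 + S' 0 * y 0)
      (hy : ∀ n : ℕ, 1 ≤ n → y (n + 2) = (T' n + ω' * U' n) * y (n + 1) + S' n * y n) (k : ℕ) :
      y (k + 2)
        = (4 * k + 7) * ((4 * k + 5) * (4 * k + 9) * (2 * w ^ 2 + 1) + 9) * y (k + 1)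
          - 16 * ((k : ℝ) + 2) ^ 2 * (2 * k + 1) ^ 2 * (4 * k + 1) * (4 * k + 9) * y k := by
    have h : y (k + 2) = (T' k + ω' * U' k) * y (k + 1) + S' k * y k := by
      rcases Nat.eq_zero_or_pos k with rfl | hk
      · exact h2
      · exact hy k hk
    rw [h, hS', hT', hU', hx]
    ring
  have hPrec := hrec P (by simp [hP, hp2, hp0]; ring) fun n hn => by
    simp [hP, hp n hn, Nat.one_le_iff_ne_zero.1 hn]; ring
  have hErec := hrec E (by simp [hE, hp2, hq2, hp0, hq0]; ring) fun n hn => by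
    simp [hE, hp n hn, hq n hn, Nat.one_le_iff_ne_zero.1 hn]; ring
  have hPle := two_pow_mul_jacobiScale_le (by linarith) (by simp [hP])
    (by simp [hP, hp1]; linarith) hPrec
  have hEeq := eq_jacobiScale_mul_jacobiIntegral (κ := -(2 * w ^ 2)) hw
    (by
      simp only [hE, if_true, jacobiIntegral_zero hw, hθ]
      field_simp
      rw [hsq]
      ring)
    (by
      simp only [hE, one_ne_zero, if_false, hp1, hq1, ← hx, jacobiIntegral_one hw, hθ]
      field_simp
      have h3 : w ^ 3 = 5 * w + 2 := by linear_combination (w + 2) * hsq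
      have h4 : w ^ 4 = 12 * w + 5 := by linear_combination (w ^ 2 + 2 * w + 5) * hsq
      ring_nf
      simp only [h3, h4, hsq]
      ring) hErec
  have hbound (n : ℕ) (hn : n ≠ 0) : ‖q n / p n - π / 4‖ ≤ 2 * w ^ 2 * (1 / 2) ^ n := by
    have hc := jacobiScale_pos n
    have hPn : P n = -p n := by simp [hP, hn]
    have hPpos : 0 < P n := lt_of_lt_of_le (by positivity) (hPle n)
    have hpn : p n ≠ 0 := by intro h; rw [hPn, h] at hPpos; simp at hPpos
    have hquot : q n / p n - π / 4 = 2 * w ^ 2 * (jacobiScale n * jacobiIntegral w n) / P n := by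
      have h := hEeq n
      simp only [hE, hn, if_false] at h
      rw [hPn]
      field_simp
      linear_combination 4 * h
    have hJ := abs_jacobiIntegral_le (show 1 ≤ w by linarith) n
    rw [hquot, Real.norm_eq_abs, abs_div, abs_mul (2 * w ^ 2), abs_mul (jacobiScale n),
      abs_of_pos hc, abs_of_pos hPpos, abs_of_pos (show 0 < 2 * w ^ 2 by positivity),
      div_le_iff₀ hPpos]
    calc 2 * w ^ 2 * (jacobiScale n * |jacobiIntegral w n|)
        ≤ 2 * w ^ 2 * (jacobiScale n * 1) := by gcongr
      _ = 2 * w ^ 2 * (1 / 2) ^ n * (2 ^ n * jacobiScale n) := by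
          rw [one_div, inv_pow]; field_simp
      _ ≤ 2 * w ^ 2 * (1 / 2) ^ n * P n := by gcongr; exact hPle n
  rw [← tendsto_sub_nhds_zero_iff]
  refine squeeze_zero_norm' ((eventually_ne_atTop 0).mono hbound) ?_
  simpa using (tendsto_pow_atTop_nhds_zero_of_lt_one (r := (1 / 2 : ℝ)) (by norm_num)
    (by norm_num)).const_mul (2 * w ^ 2)
end
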